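/- arXiv:2004.10194 — 2 statements merged into one kernel-verified Lean document; each statement's English description precedes it below -/
import Mathlib

section
/- Let k ≥ 2 be an integer, let Ω ⊂ ℝ² be a compact strictly convex set with 0 in its interior whose support function s_Ω(x) = sup_{v ∈ Ω}⟨x, v⟩ is of class C^k on ℝ² ∖ {0}, and fix a, b ∈ {−1, 0, 1}. Consider the vertical subsystem: h = (h₁, h₂, h₃) : [0, T] → ℝ³ Lipschitz and u : [0, T] → Ω measurable with u₁(t)h₁(t) + u₂(t)h₂(t) = s_Ω(h₁(t), h₂(t)) a.e. and h₁' = −u₂h₃, h₂' = u₁h₃, h₃' = −a u₁h₂ − b u₂h₁ a.e., with s_Ω(h₁(0), h₂(0)) > 0. Then: any two such pairs (h, u) and (h̃, ũ) with h(0) = h̃(0) satisfy h ≡ h̃ on [0, T] and u = ũ a.e.; moreover h is of class C^k and u agrees a.e. with a C^{k−1} function. -/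
open MeasureTheory

/-- The support function of a set `Ω ⊆ ℝ²`: `s_Ω(x) = sup_{v ∈ Ω} ⟨x, v⟩`. -/
noncomputable def suppFn (Ω : Set (ℝ × ℝ)) (x : ℝ × ℝ) : ℝ :=
  sSup ((fun v : ℝ × ℝ => x.1 * v.1 + x.2 * v.2) '' Ω)

/-- `(h₁, h₂, h₃)` (Lipschitz) and a measurable control `u` form a Pontryagin extremal of the
vertical subsystem on `[0, T]`: a.e. `u(t) ∈ Ω`, the maximality condition
`u₁h₁ + u₂h₂ = s_Ω(h₁, h₂)` holds, and `h₁' = -u₂h₃`, `h₂' = u₁h₃`,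
`h₃' = -(a u₁h₂ + b u₂h₁)`. -/
def VertExtremal (Ω : Set (ℝ × ℝ)) (a b T : ℝ)
    (h1 h2 h3 : ℝ → ℝ) (u : ℝ → ℝ × ℝ) : Prop :=
  (∃ K : NNReal, LipschitzOnWith K h1 (Set.Icc 0 T) ∧
    LipschitzOnWith K h2 (Set.Icc 0 T) ∧ LipschitzOnWith K h3 (Set.Icc 0 T)) ∧
  Measurable u ∧
  ∀ᵐ t ∂MeasureTheory.volume, t ∈ Set.Icc (0 : ℝ) T →
    u t ∈ Ω ∧
    (u t).1 * h1 t + (u t).2 * h2 t = suppFn Ω (h1 t, h2 t) ∧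
    HasDerivWithinAt h1 (-((u t).2 * h3 t)) (Set.Icc 0 T) t ∧
    HasDerivWithinAt h2 ((u t).1 * h3 t) (Set.Icc 0 T) t ∧
    HasDerivWithinAt h3 (-(a * (u t).1 * h2 t + b * (u t).2 * h1 t)) (Set.Icc 0 T) t

open Set Filter Topology

theorem hasDerivWithinAt_Icc_of_ae {E : Type*} [NormedAddCommGroup E] [NormedSpace ℝ E]
    [CompleteSpace E] {f V : ℝ → E} {a b : ℝ} {K : NNReal}
    (hf : LipschitzOnWith K f (Icc a b)) (hV : ContinuousOn V (Icc a b))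
    (hd : ∀ᵐ t, t ∈ Icc a b → HasDerivWithinAt f (V t) (Icc a b) t) :
    ∀ t ∈ Icc a b, HasDerivWithinAt f (V t) (Icc a b) t := by
  intro t ht
  have hab : a ≤ b := ht.1.trans ht.2
  have hint : IntervalIntegrable V volume a b :=
    ContinuousOn.intervalIntegrable (by rwa [uIcc_of_le hab])
  have hφ : ∀ t ∈ Icc a b,
      HasDerivWithinAt (fun t => ∫ x in a..t, V x) (V t) (Icc a b) t := by
    intro t ht
    have : Fact (t ∈ Icc a b) := ⟨ht⟩
    refine intervalIntegral.integral_hasDerivWithinAt_right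
      (hint.mono_set ?_) ?_ (hV t ht)
    · rw [uIcc_of_le hab, uIcc_of_le ht.1]
      exact Icc_subset_Icc_right ht.2
    · exact hV.stronglyMeasurableAtFilter_nhdsWithin measurableSet_Icc t
  obtain ⟨C, hC⟩ := isCompact_Icc.exists_bound_of_continuousOn hV
  have hφlip : LipschitzOnWith C.toNNReal (fun t => ∫ x in a..t, V x) (Icc a b) :=
    (convex_Icc a b).lipschitzOnWith_of_nnnorm_hasDerivWithin_le hφ
      fun t ht => NNReal.le_toNNReal_of_coe_le (hC t ht)
  have hac : AbsolutelyContinuousOnInterval (fun t => f t - ∫ x in a..t, V x) a b :=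
    AbsolutelyContinuousOnInterval.fun_sub
      (LipschitzOnWith.absolutelyContinuousOnInterval (by rwa [uIcc_of_le hab]))
      (LipschitzOnWith.absolutelyContinuousOnInterval (by rwa [uIcc_of_le hab]))
  obtain ⟨C, hC⟩ := hac.const_of_ae_hasDerivAt_zero (by
    filter_upwards [hd, Measure.ae_ne volume a, Measure.ae_ne volume b] with s hs hsa hsb hmem
    rw [uIcc_of_le hab] at hmem
    have hnhds : Icc a b ∈ 𝓝 s :=
      Icc_mem_nhds (lt_of_le_of_ne hmem.1 hsa.symm) (lt_of_le_of_ne hmem.2 hsb)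
    simpa using ((hs hmem).hasDerivAt hnhds).fun_sub ((hφ s hmem).hasDerivAt hnhds))
  rw [uIcc_of_le hab] at hC
  have hfe : ∀ s ∈ Icc a b, f s = C + ∫ x in a..s, V x := fun s hs => by
    rw [← hC s hs]; abel
  exact ((hφ t ht).const_add C).congr hfe (hfe t ht)

theorem le_suppFn {Ω : Set (ℝ × ℝ)} (hΩ : IsCompact Ω) {v : ℝ × ℝ} (hv : v ∈ Ω) (x : ℝ × ℝ) :
    x.1 * v.1 + x.2 * v.2 ≤ suppFn Ω x :=
  le_csSup (hΩ.image (f := fun v : ℝ × ℝ => x.1 * v.1 + x.2 * v.2) (by fun_prop)).bddAbove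
    (mem_image_of_mem _ hv)

theorem suppFn_zero {Ω : Set (ℝ × ℝ)} (hne : Ω.Nonempty) : suppFn Ω 0 = 0 := by
  simp [suppFn, hne.image_const]

theorem exists_lipschitzWith_suppFn {Ω : Set (ℝ × ℝ)} (hΩ : IsCompact Ω) (hne : Ω.Nonempty) :
    ∃ K, LipschitzWith K (suppFn Ω) := by
  obtain ⟨C, hC0, hC⟩ := hΩ.isBounded.exists_pos_norm_le
  refine ⟨(2 * C).toNNReal, LipschitzWith.of_le_add_mul _ fun x y => ?_⟩
  rw [Real.coe_toNNReal _ (by positivity)]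
  refine csSup_le (hne.image _) ?_
  rintro _ ⟨v, hv, rfl⟩
  have hy := le_suppFn hΩ hv y
  have hvC := hC v hv
  have h1 : (x.1 - y.1) * v.1 ≤ dist x y * C := by
    refine (le_abs_self _).trans ?_
    rw [abs_mul]
    exact mul_le_mul (by rw [dist_eq_norm]; exact norm_fst_le (x - y))
      ((norm_fst_le v).trans hvC) (abs_nonneg _) dist_nonneg
  have h2 : (x.2 - y.2) * v.2 ≤ dist x y * C := by
    refine (le_abs_self _).trans ?_
    rw [abs_mul]
    exact mul_le_mul (by rw [dist_eq_norm]; exact norm_snd_le (x - y))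
      ((norm_snd_le v).trans hvC) (abs_nonneg _) dist_nonneg
  linarith

/-- The gradient of a function on the plane, in coordinates. -/
noncomputable def planeGrad (s : ℝ × ℝ → ℝ) (x : ℝ × ℝ) : ℝ × ℝ :=
  (fderiv ℝ s x (1, 0), fderiv ℝ s x (0, 1))

/-- A point of `Ω` at which the support function is attained is the gradient of the support
function. -/
theorem eq_planeGrad_suppFn {Ω : Set (ℝ × ℝ)} (hΩ : IsCompact Ω) {v x : ℝ × ℝ} (hv : v ∈ Ω)
    (hmax : v.1 * x.1 + v.2 * x.2 = suppFn Ω x) (hd : DifferentiableAt ℝ (suppFn Ω) x) :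
    v = planeGrad (suppFn Ω) x := by
  let L : ℝ × ℝ →L[ℝ] ℝ :=
    v.1 • ContinuousLinearMap.fst ℝ ℝ ℝ + v.2 • ContinuousLinearMap.snd ℝ ℝ ℝ
  have hmin : IsLocalMin (fun y => suppFn Ω y - L y) x := by
    refine Eventually.of_forall fun y => ?_
    have := le_suppFn hΩ hv y
    simp only [L, add_apply, smul_apply,
      ContinuousLinearMap.coe_fst', ContinuousLinearMap.coe_snd', smul_eq_mul]
    linarith
  have h0 := hmin.hasFDerivAt_eq_zero (hd.hasFDerivAt.sub L.hasFDerivAt)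
  have hL : fderiv ℝ (suppFn Ω) x = L := sub_eq_zero.mp h0
  ext <;> simp [planeGrad, hL, L]

theorem contDiffOn_planeGrad {s : ℝ × ℝ → ℝ} {U : Set (ℝ × ℝ)} (hU : IsOpen U) {n : ℕ}
    (hs : ContDiffOn ℝ ((n + 1 : ℕ) : WithTop ℕ∞) s U) :
    ContDiffOn ℝ (n : WithTop ℕ∞) (planeGrad s) U := by
  have h := hs.fderiv_of_isOpen hU (m := (n : WithTop ℕ∞)) (by norm_cast)
  exact (h.clm_apply contDiffOn_const).prodMk (h.clm_apply contDiffOn_const)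

/-- Along an extremal the support function of `(h₁, h₂)` is a first integral. -/
theorem VertExtremal.suppFn_eq {Ω : Set (ℝ × ℝ)} (hΩ : IsCompact Ω) (hne : Ω.Nonempty)
    {a b T : ℝ} {h1 h2 h3 : ℝ → ℝ} {u : ℝ → ℝ × ℝ} (hext : VertExtremal Ω a b T h1 h2 h3 u)
    {t : ℝ} (ht : t ∈ Icc 0 T) : suppFn Ω (h1 t, h2 t) = suppFn Ω (h1 0, h2 0) := by
  have hT : 0 ≤ T := ht.1.trans ht.2
  obtain ⟨⟨K, hl1, hl2, -⟩, -, hae⟩ := hext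
  obtain ⟨C, hC⟩ := exists_lipschitzWith_suppFn hΩ hne
  have hlip := hC.comp_lipschitzOnWith (hl1.prodMk hl2)
  have hac : AbsolutelyContinuousOnInterval (suppFn Ω ∘ fun t => (h1 t, h2 t)) 0 T :=
    LipschitzOnWith.absolutelyContinuousOnInterval (by rwa [uIcc_of_le hT])
  obtain ⟨c, hc⟩ := hac.const_of_ae_hasDerivAt_zero (by
    filter_upwards [hae, hlip.ae_differentiableWithinAt_of_mem, Measure.ae_ne volume 0,
      Measure.ae_ne volume T] with s hs hds hs0 hsT hmem
    rw [uIcc_of_le hT] at hmem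
    have hnhds : Icc 0 T ∈ 𝓝 s :=
      Icc_mem_nhds (lt_of_le_of_ne hmem.1 hs0.symm) (lt_of_le_of_ne hmem.2 hsT)
    obtain ⟨huΩ, hmax, hd1, hd2, -⟩ := hs hmem
    have hd := ((hds hmem).differentiableAt hnhds).hasDerivAt
    have hp := ((hd1.hasDerivAt hnhds).const_mul (u s).1).add
      ((hd2.hasDerivAt hnhds).const_mul (u s).2)
    have hmin : IsLocalMin (fun τ => (suppFn Ω ∘ fun t => (h1 t, h2 t)) τ -
        ((u s).1 * h1 τ + (u s).2 * h2 τ)) s := by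
      refine Eventually.of_forall fun τ => ?_
      have := le_suppFn hΩ huΩ (h1 τ, h2 τ)
      simp only [Function.comp_apply] at this ⊢
      linarith
    have h0 := hmin.hasDerivAt_eq_zero (hd.sub hp)
    have hz : deriv (suppFn Ω ∘ fun t => (h1 t, h2 t)) s = 0 := by linarith
    rwa [hz] at hd)
  rw [uIcc_of_le hT] at hc
  exact (hc t ht).trans (hc 0 ⟨le_rfl, hT⟩).symm

/-- The closed-loop vector field of the vertical subsystem. -/
noncomputable def vertField (Ω : Set (ℝ × ℝ)) (a b : ℝ) (x : ℝ × ℝ × ℝ) : ℝ × ℝ × ℝ :=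
  (-((planeGrad (suppFn Ω) (x.1, x.2.1)).2 * x.2.2),
    (planeGrad (suppFn Ω) (x.1, x.2.1)).1 * x.2.2,
    -(a * (planeGrad (suppFn Ω) (x.1, x.2.1)).1 * x.2.1 +
      b * (planeGrad (suppFn Ω) (x.1, x.2.1)).2 * x.1))

theorem contDiffOn_vertField {Ω : Set (ℝ × ℝ)} {n : ℕ}
    (hs : ContDiffOn ℝ ((n + 1 : ℕ) : WithTop ℕ∞) (suppFn Ω) ({0} : Set (ℝ × ℝ))ᶜ) (a b : ℝ) :
    ContDiffOn ℝ (n : WithTop ℕ∞) (vertField Ω a b) {x | (x.1, x.2.1) ≠ 0} := by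
  have hg : ContDiffOn ℝ (n : WithTop ℕ∞)
      (fun x : ℝ × ℝ × ℝ => planeGrad (suppFn Ω) (x.1, x.2.1)) {x | (x.1, x.2.1) ≠ 0} :=
    (contDiffOn_planeGrad isOpen_compl_singleton hs).comp (by fun_prop) fun x hx => hx
  have hg1 := hg.fst
  have hg2 := hg.snd
  unfold vertField
  fun_prop

theorem VertExtremal.ne_zero {Ω : Set (ℝ × ℝ)} (hΩ : IsCompact Ω) (hne : Ω.Nonempty)
    {a b T : ℝ} {h1 h2 h3 : ℝ → ℝ} {u : ℝ → ℝ × ℝ} (hext : VertExtremal Ω a b T h1 h2 h3 u)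
    (hpos : 0 < suppFn Ω (h1 0, h2 0)) {t : ℝ} (ht : t ∈ Icc 0 T) : (h1 t, h2 t) ≠ 0 := by
  intro h
  have := hext.suppFn_eq hΩ hne ht
  rw [h, suppFn_zero hne] at this
  exact hpos.ne this

theorem VertExtremal.ae_eq_planeGrad {Ω : Set (ℝ × ℝ)} (hΩ : IsCompact Ω) (hne : Ω.Nonempty)
    (hs : DifferentiableOn ℝ (suppFn Ω) ({0} : Set (ℝ × ℝ))ᶜ)
    {a b T : ℝ} {h1 h2 h3 : ℝ → ℝ} {u : ℝ → ℝ × ℝ} (hext : VertExtremal Ω a b T h1 h2 h3 u)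
    (hpos : 0 < suppFn Ω (h1 0, h2 0)) :
    ∀ᵐ t, t ∈ Icc 0 T → u t = planeGrad (suppFn Ω) (h1 t, h2 t) := by
  filter_upwards [hext.2.2] with t h ht
  obtain ⟨hu, hmax, -⟩ := h ht
  exact eq_planeGrad_suppFn hΩ hu hmax
    (hs.differentiableAt (isOpen_compl_singleton.mem_nhds (hext.ne_zero hΩ hne hpos ht)))

/-- An extremal is a classical solution of the closed-loop system. -/
theorem VertExtremal.hasDerivWithinAt {Ω : Set (ℝ × ℝ)} (hΩ : IsCompact Ω) (hne : Ω.Nonempty)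
    {n : ℕ} (hs : ContDiffOn ℝ ((n + 1 : ℕ) : WithTop ℕ∞) (suppFn Ω) ({0} : Set (ℝ × ℝ))ᶜ)
    {a b T : ℝ} {h1 h2 h3 : ℝ → ℝ} {u : ℝ → ℝ × ℝ} (hext : VertExtremal Ω a b T h1 h2 h3 u)
    (hpos : 0 < suppFn Ω (h1 0, h2 0)) :
    ∀ t ∈ Icc 0 T, HasDerivWithinAt (fun t => (h1 t, h2 t, h3 t))
      (vertField Ω a b (h1 t, h2 t, h3 t)) (Icc 0 T) t := by
  have hu := hext.ae_eq_planeGrad hΩ hne (hs.differentiableOn (by simp)) hpos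
  have hnz := fun t => hext.ne_zero hΩ hne hpos (t := t)
  obtain ⟨⟨K, hl1, hl2, hl3⟩, -, hae⟩ := hext
  have hlip := hl1.prodMk (hl2.prodMk hl3)
  refine hasDerivWithinAt_Icc_of_ae hlip
    ((contDiffOn_vertField hs a b).continuousOn.comp hlip.continuousOn hnz) ?_
  filter_upwards [hae, hu] with t h hut ht
  obtain ⟨-, -, hd1, hd2, hd3⟩ := h ht
  rw [hut ht] at hd1 hd2 hd3
  exact hd1.prodMk (hd2.prodMk hd3)

theorem LocallyLipschitzOn.of_contDiffOn_isOpen {E F : Type*} [NormedAddCommGroup E]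
    [NormedSpace ℝ E] [NormedAddCommGroup F] [NormedSpace ℝ F] {f : E → F} {U : Set E}
    (hU : IsOpen U) (hf : ContDiffOn ℝ 1 f U) : LocallyLipschitzOn U f := by
  intro x hx
  obtain ⟨K, t, ht, hK⟩ := (hf.contDiffAt (hU.mem_nhds hx)).exists_lipschitzOnWith
  exact ⟨K, t, mem_nhdsWithin_of_mem_nhds ht, hK⟩

/-- Two solutions in an open set of an autonomous `C¹` equation with the same initial value
coincide. -/
theorem eqOn_Icc_of_hasDerivWithinAt {E : Type*} [NormedAddCommGroup E] [NormedSpace ℝ E]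
    {V : E → E} {U : Set E} (hU : IsOpen U) (hV : ContDiffOn ℝ 1 V U) {f g : ℝ → E} {a b : ℝ}
    (hf : ∀ t ∈ Icc a b, HasDerivWithinAt f (V (f t)) (Icc a b) t) (hfU : MapsTo f (Icc a b) U)
    (hg : ∀ t ∈ Icc a b, HasDerivWithinAt g (V (g t)) (Icc a b) t) (hgU : MapsTo g (Icc a b) U)
    (hfg : f a = g a) : EqOn f g (Icc a b) := by
  have hfc : ContinuousOn f (Icc a b) := fun t ht => (hf t ht).continuousWithinAt
  have hgc : ContinuousOn g (Icc a b) := fun t ht => (hg t ht).continuousWithinAt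
  obtain ⟨K, hK⟩ := LocallyLipschitzOn.exists_lipschitzOnWith_of_compact
    ((isCompact_Icc.image_of_continuousOn hfc).union (isCompact_Icc.image_of_continuousOn hgc))
    ((LocallyLipschitzOn.of_contDiffOn_isOpen hU hV).mono
      (union_subset hfU.image_subset hgU.image_subset))
  have hnhds : ∀ t ∈ Ico a b, Icc a b ∈ 𝓝[≥] t := fun t ht => Icc_mem_nhdsGE_of_mem ht
  exact ODE_solution_unique_of_mem_Icc_right (v := fun _ => V) (fun _ _ => hK) hfc
    (fun t ht => (hf t (Ico_subset_Icc_self ht)).mono_of_mem_nhdsWithin (hnhds t ht))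
    (fun t ht => .inl (mem_image_of_mem f (Ico_subset_Icc_self ht))) hgc
    (fun t ht => (hg t (Ico_subset_Icc_self ht)).mono_of_mem_nhdsWithin (hnhds t ht))
    (fun t ht => .inr (mem_image_of_mem g (Ico_subset_Icc_self ht))) hfg

/-- Solutions of an autonomous `C^n` equation are `C^(n+1)`. -/
theorem contDiffOn_succ_Icc_of_hasDerivWithinAt {E : Type*} [NormedAddCommGroup E]
    [NormedSpace ℝ E] [CompleteSpace E] {V : E → E} {U : Set E} {n : ℕ}
    (hV : ContDiffOn ℝ (n : WithTop ℕ∞) V U) {f : ℝ → E} {a b : ℝ}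
    (hf : ∀ t ∈ Icc a b, HasDerivWithinAt f (V (f t)) (Icc a b) t)
    (hfU : MapsTo f (Icc a b) U) : ContDiffOn ℝ ((n + 1 : ℕ) : WithTop ℕ∞) f (Icc a b) := by
  rcases lt_or_ge a b with hab | hab
  · have hn : ContDiffOn ℝ (n : WithTop ℕ∞) f (Icc a b) :=
      ODE.contDiffOn_enat_Icc_of_hasDerivWithinAt (f := fun _ => V) (n := (n : ℕ∞))
        (hV.comp contDiffOn_snd fun x hx => hx.2) hf hfU
    have hud := uniqueDiffOn_Icc hab
    push_cast
    rw [contDiffOn_succ_iff_derivWithin hud]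
    exact ⟨fun t ht => (hf t ht).differentiableWithinAt, by simp,
      (hV.comp hn hfU).congr fun t ht => (hf t ht).derivWithin (hud t ht)⟩
  · intro t ht
    rw [(subsingleton_Icc_of_ge hab).eq_singleton_of_mem ht]
    exact contDiffWithinAt_singleton

/-- If `Ω` is compact, strictly convex, with `0` in its interior, and its
support function is `C^k` (`k ≥ 2`) away from the origin, then solutions of the vertical
subsystem with `s_Ω(h₁(0), h₂(0)) > 0` are unique (same initial point ⇒ same extremal and
a.e. the same control) and `C^k`-smooth, with control a.e. equal to a `C^{k-1}` function. -/
theorem stmt_18 (k : ℕ) (hk : 2 ≤ k) (Ω : Set (ℝ × ℝ)) (hcomp : IsCompact Ω)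
    (hstrict : StrictConvex ℝ Ω) (h0 : (0 : ℝ × ℝ) ∈ interior Ω)
    (hsmooth : ContDiffOn ℝ ((k : ℕ) : WithTop ℕ∞) (suppFn Ω) ({0} : Set (ℝ × ℝ))ᶜ)
    (a b : ℝ) (ha : a ∈ ({-1, 0, 1} : Set ℝ)) (hb : b ∈ ({-1, 0, 1} : Set ℝ))
    (T : ℝ) (hT : 0 ≤ T)
    (h1 h2 h3 : ℝ → ℝ) (u : ℝ → ℝ × ℝ) (hext : VertExtremal Ω a b T h1 h2 h3 u)
    (g1 g2 g3 : ℝ → ℝ) (v : ℝ → ℝ × ℝ) (hext' : VertExtremal Ω a b T g1 g2 g3 v)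
    (hpos : 0 < suppFn Ω (h1 0, h2 0))
    (hinit : h1 0 = g1 0 ∧ h2 0 = g2 0 ∧ h3 0 = g3 0) :
    (∀ t ∈ Set.Icc (0 : ℝ) T, h1 t = g1 t ∧ h2 t = g2 t ∧ h3 t = g3 t) ∧
    (∀ᵐ t ∂volume, t ∈ Set.Icc (0 : ℝ) T → u t = v t) ∧
    (ContDiffOn ℝ ((k : ℕ) : WithTop ℕ∞) h1 (Set.Icc 0 T) ∧
      ContDiffOn ℝ ((k : ℕ) : WithTop ℕ∞) h2 (Set.Icc 0 T) ∧
      ContDiffOn ℝ ((k : ℕ) : WithTop ℕ∞) h3 (Set.Icc 0 T)) ∧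
    ∃ w : ℝ → ℝ × ℝ, ContDiffOn ℝ ((k - 1 : ℕ) : WithTop ℕ∞) w (Set.Icc 0 T) ∧
      ∀ᵐ t ∂volume, t ∈ Set.Icc (0 : ℝ) T → u t = w t := by
  obtain ⟨n, rfl⟩ : ∃ n, k = n + 1 := ⟨k - 1, by omega⟩
  have hn : 1 ≤ n := by omega
  have hne : Ω.Nonempty := ⟨0, interior_subset h0⟩
  have hpos' : 0 < suppFn Ω (g1 0, g2 0) := by rwa [← hinit.1, ← hinit.2.1]
  have hdiff : DifferentiableOn ℝ (suppFn Ω) ({0} : Set (ℝ × ℝ))ᶜ :=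
    hsmooth.differentiableOn (by simp)
  have hV := contDiffOn_vertField hsmooth a b
  have hU : IsOpen {x : ℝ × ℝ × ℝ | (x.1, x.2.1) ≠ 0} :=
    isOpen_compl_singleton.preimage (f := fun x : ℝ × ℝ × ℝ => (x.1, x.2.1)) (by fun_prop)
  have hd := hext.hasDerivWithinAt hcomp hne hsmooth hpos
  have hmaps : MapsTo (fun t => (h1 t, h2 t, h3 t)) (Icc 0 T) {x | (x.1, x.2.1) ≠ 0} :=
    fun t ht => hext.ne_zero hcomp hne hpos ht
  have heq : EqOn (fun t => (h1 t, h2 t, h3 t)) (fun t => (g1 t, g2 t, g3 t)) (Icc 0 T) :=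
    eqOn_Icc_of_hasDerivWithinAt hU (hV.of_le (by exact_mod_cast hn)) hd hmaps
      (hext'.hasDerivWithinAt hcomp hne hsmooth hpos')
      (fun t ht => hext'.ne_zero hcomp hne hpos' ht) (by simp [hinit])
  have heq' : ∀ t ∈ Icc (0 : ℝ) T, h1 t = g1 t ∧ h2 t = g2 t ∧ h3 t = g3 t :=
    fun t ht => by simpa using heq ht
  have hu := hext.ae_eq_planeGrad hcomp hne hdiff hpos
  have hv := hext'.ae_eq_planeGrad hcomp hne hdiff hpos'
  have hC := contDiffOn_succ_Icc_of_hasDerivWithinAt hV hd hmaps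
  refine ⟨heq', ?_, ⟨hC.fst, hC.snd.fst, hC.snd.snd⟩,
    fun t => planeGrad (suppFn Ω) (h1 t, h2 t), ?_, hu⟩
  · filter_upwards [hu, hv] with t hut hvt ht
    rw [hut ht, hvt ht, (heq' t ht).1, (heq' t ht).2.1]
  · exact (contDiffOn_planeGrad isOpen_compl_singleton hsmooth).comp
      ((hC.fst.prodMk hC.snd.fst).of_le (by norm_cast; omega)) hmaps
end

section
/- Let p ∈ (2, ∞) and Ω = {(u₁, u₂) ∈ ℝ² : |u₁|^p + |u₂|^p ≤ 1}, let a = 1, and let b ∈ {−1, 0, 1}. Then Cauchy uniqueness fails for the vertical subsystem: there exist T > 0, a point h⁰ ∈ ℝ³ with s_Ω(h⁰₁, h⁰₂) > 0, and two pairs (h, u), (h̃, ũ), where h, h̃ : [0, T] → ℝ³ are Lipschitz and u, ũ : [0, T] → Ω are measurable, both satisfying the equations h₁' = −u₂h₃, h₂' = u₁h₃, h₃' = −u₁h₂ − b u₂h₁ a.e. and the maximality condition u₁h₁ + u₂h₂ = s_Ω(h₁, h₂) a.e., with h(0) = h̃(0) = h⁰ but h ≢ h̃ on [0, T]. -/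
open MeasureTheory

open Set Filter Topology MeasureTheory

/-- A function continuous on `[a, b]` whose derivative on `(a, b)` extends continuously to `[a, b]`
is Lipschitz on `[a, b]`. -/
lemma exists_lipschitzOnWith_Icc_of_hasDerivAt {a b : ℝ} (hab : a < b) {f f' : ℝ → ℝ}
    (hf : ContinuousOn f (Icc a b)) (hf' : ContinuousOn f' (Icc a b))
    (hd : ∀ t ∈ Ioo a b, HasDerivAt f (f' t) t) :
    ∃ K : NNReal, LipschitzOnWith K f (Icc a b) := by
  obtain ⟨C, hC⟩ := isCompact_Icc.exists_bound_of_continuousOn hf'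
  refine ⟨C.toNNReal, ?_⟩
  rw [← closure_Ioo hab.ne] at hf ⊢
  refine LipschitzOnWith.closure hf ?_
  refine (convex_Ioo a b).lipschitzOnWith_of_nnnorm_hasDerivWithin_le
    (fun t ht => (hd t ht).hasDerivWithinAt) fun t ht => ?_
  rw [← NNReal.coe_le_coe, coe_nnnorm]
  exact (hC t (Ioo_subset_Icc_self ht)).trans (Real.le_coe_toNNReal C)

/-- If `F` is continuous on `(0, ε)` and bounded below there by `c x ^ r` with `c > 0` and `r < 1`,
then the autonomous equation with right-hand side `F` has a solution which leaves `0` at time `0`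
and reaches `ε` in finite time. -/
lemma exists_solution_leaving_zero {F : ℝ → ℝ} {ε c r : ℝ} (hε : 0 < ε) (hc : 0 < c) (hr : r < 1)
    (hF : ContinuousOn F (Ioo 0 ε)) (hlow : ∀ x ∈ Ioo 0 ε, c * x ^ r ≤ F x) :
    ∃ T > 0, ∃ x : ℝ → ℝ, Continuous x ∧ x 0 = 0 ∧ x T = ε ∧
      ∀ t ∈ Ioo 0 T, x t ∈ Ioo 0 ε ∧ HasDerivAt x (F (x t)) t := by
  classical
  have hFpos : ∀ s ∈ Ioo 0 ε, 0 < F s := fun s hs =>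
    (mul_pos hc (Real.rpow_pos_of_pos hs.1 r)).trans_le (hlow s hs)
  let w : ℝ → ℝ := (Ioo 0 ε).piecewise (fun s => (F s)⁻¹) (fun _ => 1)
  have hw_in : ∀ s ∈ Ioo 0 ε, w s = (F s)⁻¹ := fun s hs => piecewise_eq_of_mem _ _ _ hs
  have hw_out : ∀ s ∉ Ioo 0 ε, w s = 1 := fun s hs => piecewise_eq_of_notMem _ _ _ hs
  have hw_pos : ∀ s, 0 < w s := fun s => by
    by_cases hs : s ∈ Ioo 0 ε
    · rw [hw_in s hs]; exact inv_pos.2 (hFpos s hs)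
    · rw [hw_out s hs]; exact one_pos
  have hFinv : ContinuousOn (fun s => (F s)⁻¹) (Ioo 0 ε) := hF.inv₀ fun s hs => (hFpos s hs).ne'
  have hw_meas : Measurable w :=
    ContinuousOn.measurable_piecewise hFinv continuousOn_const measurableSet_Ioo
  have hw_int : ∀ a b, IntervalIntegrable w volume a b := by
    intro a b
    have hg : IntervalIntegrable (fun s : ℝ => 1 + c⁻¹ * ‖s ^ (-r)‖) volume a b :=
      intervalIntegrable_const.add
        ((intervalIntegral.intervalIntegrable_rpow' (by linarith)).norm.const_mul _)
    refine hg.mono_fun hw_meas.aestronglyMeasurable (Eventually.of_forall fun s => ?_)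
    have h0 : 0 ≤ c⁻¹ * ‖s ^ (-r)‖ := by positivity
    simp only
    rw [Real.norm_of_nonneg (hw_pos s).le, Real.norm_of_nonneg (by positivity)]
    by_cases hs : s ∈ Ioo 0 ε
    · have h1 : w s ≤ c⁻¹ * ‖s ^ (-r)‖ := by
        rw [hw_in s hs, Real.norm_of_nonneg (Real.rpow_nonneg hs.1.le _), Real.rpow_neg hs.1.le,
          ← mul_inv]
        exact inv_anti₀ (mul_pos hc (Real.rpow_pos_of_pos hs.1 r)) (hlow s hs)
      linarith
    · rw [hw_out s hs]; linarith
  let τ : ℝ → ℝ := fun y => ∫ s in (0 : ℝ)..y, w s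
  have hτ0 : τ 0 = 0 := intervalIntegral.integral_same
  have hτ_cont : Continuous τ := intervalIntegral.continuous_primitive hw_int 0
  have hτ_sub : ∀ y z, τ z - τ y = ∫ s in y..z, w s := fun y z =>
    intervalIntegral.integral_interval_sub_left (hw_int _ _) (hw_int _ _)
  have hτ_mono : StrictMono τ := fun y z hyz => by
    have := intervalIntegral.intervalIntegral_pos_of_pos (hw_int y z) hw_pos hyz
    linarith [hτ_sub y z]
  have hτ_neg : ∀ y ≤ 0, τ y = y := fun y hy => by
    have h : ∫ s in (0 : ℝ)..y, w s = ∫ _ in (0 : ℝ)..y, (1 : ℝ) :=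
      intervalIntegral.integral_congr fun s hs => by
        rw [uIcc_of_ge hy] at hs
        exact hw_out s fun h => absurd h.1 (not_lt.2 hs.2)
    simpa [τ] using h
  have hτ_large : ∀ y, ε ≤ y → τ y = τ ε + (y - ε) := fun y hy => by
    have h : ∫ s in ε..y, w s = ∫ _ in ε..y, (1 : ℝ) :=
      intervalIntegral.integral_congr fun s hs => by
        rw [uIcc_of_le hy] at hs
        exact hw_out s fun h => absurd h.2 (not_lt.2 hs.1)
    rw [← hτ_sub] at h
    simp at h
    linarith
  have hτ_surj : Function.Surjective τ := by
    refine hτ_cont.surjective ?_ ?_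
    · refine Tendsto.congr' ?_ (tendsto_atTop_add_const_left _ (τ ε - ε) tendsto_id)
      filter_upwards [eventually_ge_atTop ε] with y hy
      rw [hτ_large y hy, id]; ring
    · refine Tendsto.congr' ?_ tendsto_id
      filter_upwards [eventually_le_atBot 0] with y hy
      rw [hτ_neg y hy, id]
  let e : ℝ ≃o ℝ := hτ_mono.orderIsoOfSurjective τ hτ_surj
  have he : ∀ y, e y = τ y := fun _ => rfl
  have hx0 : e.symm 0 = 0 := by rw [e.symm_apply_eq, he, hτ0]
  have hxT : e.symm (τ ε) = ε := by rw [e.symm_apply_eq, he]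
  refine ⟨τ ε, by simpa [hτ0] using hτ_mono hε, e.symm, e.symm.continuous, hx0, hxT,
    fun t ht => ?_⟩
  have hmem : e.symm t ∈ Ioo 0 ε :=
    ⟨by simpa [hx0] using e.symm.strictMono ht.1, by simpa [hxT] using e.symm.strictMono ht.2⟩
  refine ⟨hmem, ?_⟩
  have hw_contAt : ContinuousAt w (e.symm t) := by
    have hnhds := isOpen_Ioo.mem_nhds hmem
    refine (hFinv.continuousAt hnhds).congr ?_
    filter_upwards [hnhds] with s hs
    exact (hw_in s hs).symm
  have hderiv : HasDerivAt τ (F (e.symm t))⁻¹ (e.symm t) := by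
    rw [← hw_in _ hmem]
    exact intervalIntegral.integral_hasDerivAt_right (hw_int _ _)
      hw_meas.stronglyMeasurable.stronglyMeasurableAtFilter hw_contAt
  simpa using hderiv.of_local_left_inverse e.symm.continuous.continuousAt
    (inv_ne_zero (hFpos _ hmem).ne') (Eventually.of_forall fun y => e.apply_symm_apply y)

/-- The exponents `q - 1` and `p` compose to `q` when `p` and `q` are conjugate. -/
lemma rpow_sub_one_rpow_conj {p q : ℝ} (hpq : p.HolderConjugate q) {x : ℝ} (hx : 0 ≤ x) :
    |x ^ (q - 1)| ^ p = x ^ q := by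
  rw [abs_of_nonneg (Real.rpow_nonneg hx _), ← Real.rpow_mul hx, hpq.symm.sub_one_mul_conj]

/-- The gradient of the dual norm at a point of the closed first quadrant of its unit sphere lies
in the `ℓ_p` unit ball. -/
lemma rpow_sub_one_mem_lpBall {p q : ℝ} (hpq : p.HolderConjugate q) {x y : ℝ} (hx : 0 ≤ x)
    (hy : 0 ≤ y) (hxy : x ^ q + y ^ q = 1) :
    (x ^ (q - 1), y ^ (q - 1)) ∈ {w : ℝ × ℝ | |w.1| ^ p + |w.2| ^ p ≤ 1} := by
  rw [mem_ofPred_eq, rpow_sub_one_rpow_conj hpq hx, rpow_sub_one_rpow_conj hpq hy, hxy]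

lemma rpow_sub_one_mul_self {q : ℝ} (hq : 1 < q) {x : ℝ} (hx : 0 ≤ x) :
    x ^ (q - 1) * x = x ^ q := by
  rw [← Real.rpow_add_one' hx (by linarith), sub_add_cancel]

/-- On the closed first quadrant of the unit sphere of the dual norm, the support function of the
`ℓ_p` unit ball equals `1`. -/
lemma suppFn_lpBall_eq_one {p q : ℝ} (hpq : p.HolderConjugate q) {x y : ℝ} (hx : 0 ≤ x)
    (hy : 0 ≤ y) (hxy : x ^ q + y ^ q = 1) :
    suppFn {w : ℝ × ℝ | |w.1| ^ p + |w.2| ^ p ≤ 1} (x, y) = 1 := by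
  refine IsGreatest.csSup_eq ⟨⟨_, rpow_sub_one_mem_lpBall hpq hx hy hxy, ?_⟩, ?_⟩
  · simp only
    rw [mul_comm x, mul_comm y, rpow_sub_one_mul_self hpq.symm.lt hx,
      rpow_sub_one_mul_self hpq.symm.lt hy, hxy]
  · rintro _ ⟨v, hv, rfl⟩
    have hv' : |v.1| ^ p + |v.2| ^ p ≤ 1 := hv
    have h1 := Real.young_inequality v.1 x hpq
    have h2 := Real.young_inequality v.2 y hpq
    rw [abs_of_nonneg hx] at h1
    rw [abs_of_nonneg hy] at h2
    calc x * v.1 + y * v.2 ≤ (|v.1| ^ p + |v.2| ^ p) * p⁻¹ + (x ^ q + y ^ q) * q⁻¹ := by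
          simp only [div_eq_mul_inv] at h1 h2; linarith
      _ ≤ 1 * p⁻¹ + 1 * q⁻¹ := by
          rw [hxy]
          gcongr
          exact hpq.inv_nonneg
      _ = 1 := by rw [one_mul, one_mul, hpq.inv_add_inv_eq_one]

/-- The arc `x^q + y^q = 1` of the dual unit sphere in the first quadrant, as a graph over `x`. -/
noncomputable def dualArc (q x : ℝ) : ℝ := (1 - x ^ q) ^ q⁻¹

lemma continuous_dualArc {q : ℝ} (hq : 1 < q) : Continuous (dualArc q) := by
  have h0 : 0 ≤ q := by linarith
  exact (continuous_const.sub (Real.continuous_rpow_const h0)).rpow_const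
    fun _ => Or.inr (inv_nonneg.2 h0)

section dualArc

variable {q x : ℝ}

lemma dualArc_nonneg (hq : 1 < q) (hx : x ∈ Icc 0 1) : 0 ≤ dualArc q x :=
  Real.rpow_nonneg (sub_nonneg.2 (Real.rpow_le_one hx.1 hx.2 (by linarith))) _

lemma rpow_add_dualArc_rpow (hq : 1 < q) (hx : x ∈ Icc 0 1) : x ^ q + dualArc q x ^ q = 1 := by
  rw [dualArc, Real.rpow_inv_rpow (sub_nonneg.2 (Real.rpow_le_one hx.1 hx.2 (by linarith)))
    (by linarith)]
  ring

lemma dualArc_pos (hq : 1 < q) (hx : x ∈ Ico 0 1) : 0 < dualArc q x :=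
  Real.rpow_pos_of_pos (sub_pos.2 (Real.rpow_lt_one hx.1 hx.2 (by linarith))) _

lemma dualArc_zero (hq : 1 < q) : dualArc q 0 = 1 := by
  simp [dualArc, Real.zero_rpow (by linarith : q ≠ 0)]

lemma hasDerivAt_dualArc (hq : 1 < q) (hx : x ∈ Ioo 0 1) :
    HasDerivAt (dualArc q) (-(x ^ (q - 1) / dualArc q x ^ (q - 1))) x := by
  have hpos : 0 < 1 - x ^ q := sub_pos.2 (Real.rpow_lt_one hx.1.le hx.2 (by linarith))
  have h := ((Real.hasDerivAt_rpow_const (p := q) (Or.inl hx.1.ne')).const_sub 1).rpow_const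
    (p := q⁻¹) (Or.inl hpos.ne')
  refine h.congr_deriv ?_
  have hY : (1 - x ^ q) ^ (q⁻¹ - 1) = (dualArc q x ^ (q - 1))⁻¹ := by
    rw [dualArc, ← Real.rpow_mul hpos.le, ← Real.rpow_neg hpos.le]
    congr 1
    field_simp
    ring
  rw [hY]
  have : q ≠ 0 := by linarith
  field_simp

end dualArc

/-- The value of `h₃²` in terms of `h₁ = x` on the extremals through `(0, 1, 0)`, obtained from the
Casimir function `h₂² + h₃² - b h₁²`. -/
noncomputable def casimirSq (q b x : ℝ) : ℝ := 1 - dualArc q x ^ 2 + b * x ^ 2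

lemma continuous_casimirSq {q : ℝ} (hq : 1 < q) (b : ℝ) : Continuous (casimirSq q b) :=
  (continuous_const.sub ((continuous_dualArc hq).pow 2)).add
    (continuous_const.mul (continuous_id.pow 2))

lemma casimirSq_zero {q : ℝ} (hq : 1 < q) (b : ℝ) : casimirSq q b 0 = 0 := by
  simp [casimirSq, dualArc_zero hq]

lemma hasDerivAt_casimirSq {q x : ℝ} (hq : 1 < q) (b : ℝ) (hx : x ∈ Ioo 0 1) :
    HasDerivAt (casimirSq q b)
      (2 * (dualArc q x * (x ^ (q - 1) / dualArc q x ^ (q - 1)) + b * x)) x := by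
  have h := (((hasDerivAt_dualArc hq hx).pow 2).const_sub 1).add
    (((hasDerivAt_id x).pow 2).const_mul b)
  refine h.congr_deriv ?_
  simp
  ring

lemma le_casimirSq {q b ε x : ℝ} (hq : 1 < q) (hq2 : q < 2) (hb : -1 ≤ b) (hε : ε < 1)
    (hx : x ∈ Ioo 0 ε) : (1 - ε ^ (2 - q)) * x ^ q ≤ casimirSq q b x := by
  have hx1 : x ∈ Ico 0 1 := ⟨hx.1.le, hx.2.trans hε⟩
  have hx1' : x ∈ Icc 0 1 := ⟨hx1.1, hx1.2.le⟩
  have hsphere := rpow_add_dualArc_rpow hq hx1'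
  have hxq : 0 ≤ x ^ q := Real.rpow_nonneg hx.1.le q
  have hYpos := dualArc_pos hq hx1
  have hY1 : dualArc q x ≤ 1 := Real.rpow_le_one
    (sub_nonneg.2 (Real.rpow_le_one hx1.1 hx1.2.le (by linarith))) (by linarith)
    (inv_nonneg.2 (by linarith))
  have hY2 : dualArc q x ^ 2 ≤ dualArc q x ^ q := by
    rw [← Real.rpow_two]
    exact Real.rpow_le_rpow_of_exponent_ge hYpos hY1 hq2.le
  have hx2 : x ^ 2 = x ^ (2 - q) * x ^ q := by
    rw [← Real.rpow_add hx.1, sub_add_cancel, Real.rpow_two]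
  have hxε : x ^ (2 - q) ≤ ε ^ (2 - q) := by
    have := hx.1.le
    have := hx.2.le
    gcongr
  have h1 : x ^ 2 ≤ ε ^ (2 - q) * x ^ q := by rw [hx2]; gcongr
  have h2 : -x ^ 2 ≤ b * x ^ 2 := by nlinarith [sq_nonneg x]
  unfold casimirSq
  linarith

/-- Continuous curves which satisfy the control equations pointwise in the open interval form an
extremal of the `ℓ_p` problem. -/
lemma vertExtremal_of_hasDerivAt {p q b T : ℝ} (hpq : p.HolderConjugate q) (hT : 0 < T)
    {h1 h2 h3 : ℝ → ℝ} (hc1 : Continuous h1) (hc2 : Continuous h2) (hc3 : Continuous h3)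
    (hn1 : ∀ t ∈ Ioo 0 T, 0 ≤ h1 t) (hn2 : ∀ t ∈ Ioo 0 T, 0 ≤ h2 t)
    (hsphere : ∀ t ∈ Ioo 0 T, h1 t ^ q + h2 t ^ q = 1)
    (hd1 : ∀ t ∈ Ioo 0 T, HasDerivAt h1 (-(h2 t ^ (q - 1) * h3 t)) t)
    (hd2 : ∀ t ∈ Ioo 0 T, HasDerivAt h2 (h1 t ^ (q - 1) * h3 t) t)
    (hd3 : ∀ t ∈ Ioo 0 T,
      HasDerivAt h3 (-(1 * h1 t ^ (q - 1) * h2 t + b * h2 t ^ (q - 1) * h1 t)) t) :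
    VertExtremal {w : ℝ × ℝ | |w.1| ^ p + |w.2| ^ p ≤ 1} 1 b T h1 h2 h3
      (fun t => (h1 t ^ (q - 1), h2 t ^ (q - 1))) := by
  have hq : 1 < q := hpq.symm.lt
  have hu1 : Continuous fun t => h1 t ^ (q - 1) :=
    hc1.rpow_const fun _ => Or.inr (sub_nonneg.2 hq.le)
  have hu2 : Continuous fun t => h2 t ^ (q - 1) :=
    hc2.rpow_const fun _ => Or.inr (sub_nonneg.2 hq.le)
  obtain ⟨K1, hK1⟩ := exists_lipschitzOnWith_Icc_of_hasDerivAt hT hc1.continuousOn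
    (Continuous.continuousOn (by fun_prop)) hd1
  obtain ⟨K2, hK2⟩ := exists_lipschitzOnWith_Icc_of_hasDerivAt hT hc2.continuousOn
    (Continuous.continuousOn (by fun_prop)) hd2
  obtain ⟨K3, hK3⟩ := exists_lipschitzOnWith_Icc_of_hasDerivAt hT hc3.continuousOn
    (Continuous.continuousOn (by fun_prop)) hd3
  refine ⟨⟨K1 ⊔ K2 ⊔ K3, hK1.weaken (le_sup_left.trans le_sup_left),
    hK2.weaken (le_sup_right.trans le_sup_left), hK3.weaken le_sup_right⟩,
    (hu1.prodMk hu2).measurable, ?_⟩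
  filter_upwards [compl_mem_ae_iff.2 (measure_singleton (0 : ℝ)),
    compl_mem_ae_iff.2 (measure_singleton T)] with t ht0 htT htI
  have ht : t ∈ Ioo 0 T := ⟨lt_of_le_of_ne htI.1 (Ne.symm ht0), lt_of_le_of_ne htI.2 htT⟩
  refine ⟨rpow_sub_one_mem_lpBall hpq (hn1 t ht) (hn2 t ht) (hsphere t ht), ?_,
    (hd1 t ht).hasDerivWithinAt, (hd2 t ht).hasDerivWithinAt, (hd3 t ht).hasDerivWithinAt⟩
  rw [suppFn_lpBall_eq_one hpq (hn1 t ht) (hn2 t ht) (hsphere t ht),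
    rpow_sub_one_mul_self hq (hn1 t ht), rpow_sub_one_mul_self hq (hn2 t ht), hsphere t ht]

/-- For the `ℓ_p` ball `Ω = {|u₁|^p + |u₂|^p ≤ 1}` with `2 < p < ∞`,
`a = 1` and `b ∈ {-1, 0, 1}`, Cauchy uniqueness fails for the vertical subsystem: there are
two extremals with the same initial point (at which `s_Ω(h₁, h₂) > 0`) that differ. -/
theorem stmt_19 (p : ℝ) (hp : 2 < p) (b : ℝ) (hb : b ∈ ({-1, 0, 1} : Set ℝ)) :
    ∃ T > (0 : ℝ), ∃ h01 h02 h03 : ℝ,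
      0 < suppFn {w : ℝ × ℝ | |w.1| ^ p + |w.2| ^ p ≤ 1} (h01, h02) ∧
      ∃ (h1 h2 h3 g1 g2 g3 : ℝ → ℝ) (u v : ℝ → ℝ × ℝ),
        VertExtremal {w : ℝ × ℝ | |w.1| ^ p + |w.2| ^ p ≤ 1} 1 b T h1 h2 h3 u ∧
        VertExtremal {w : ℝ × ℝ | |w.1| ^ p + |w.2| ^ p ≤ 1} 1 b T g1 g2 g3 v ∧
        h1 0 = h01 ∧ h2 0 = h02 ∧ h3 0 = h03 ∧
        g1 0 = h01 ∧ g2 0 = h02 ∧ g3 0 = h03 ∧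
        ∃ t ∈ Set.Icc (0 : ℝ) T, (h1 t, h2 t, h3 t) ≠ (g1 t, g2 t, g3 t) := by
  have hb1 : -1 ≤ b := by
    rcases hb with rfl | rfl | rfl <;> norm_num
  obtain ⟨q, hpq⟩ : ∃ q, p.HolderConjugate q := ⟨_, .conjExponent (by linarith)⟩
  have hq : 1 < q := hpq.symm.lt
  have hq2 : q < 2 := by nlinarith [hpq.mul_eq_add]
  have hq0 : q ≠ 0 := by linarith
  have hε1 : (1 / 2 : ℝ) < 1 := by norm_num
  have hsub : ∀ x ∈ Ioo (0 : ℝ) (1 / 2), x ∈ Ioo (0 : ℝ) 1 := fun x hx => ⟨hx.1, hx.2.trans hε1⟩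
  have hδ : 0 < 1 - (1 / 2 : ℝ) ^ (2 - q) :=
    sub_pos.2 (Real.rpow_lt_one (by norm_num) hε1 (by linarith))
  have hm : 0 < 1 - (1 / 2 : ℝ) ^ q :=
    sub_pos.2 (Real.rpow_lt_one (by norm_num) hε1 (by linarith))
  have hR : ∀ x ∈ Ioo (0 : ℝ) (1 / 2), 0 < casimirSq q b x := fun x hx =>
    (mul_pos hδ (Real.rpow_pos_of_pos hx.1 q)).trans_le (le_casimirSq hq hq2 hb1 hε1 hx)
  have hYc := continuous_dualArc hq
  have hRc := continuous_casimirSq hq b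
  obtain ⟨T, hT, x, hxc, hx0, hxT, hx⟩ := exists_solution_leaving_zero
    (F := fun x => dualArc q x ^ (q - 1) * √(casimirSq q b x)) (ε := 1 / 2)
    (c := dualArc q (1 / 2) ^ (q - 1) * √(1 - (1 / 2 : ℝ) ^ (2 - q))) (r := q / 2)
    (by norm_num)
    (mul_pos (Real.rpow_pos_of_pos (dualArc_pos hq ⟨by norm_num, hε1⟩) _) (Real.sqrt_pos.2 hδ))
    (by linarith)
    ((hYc.rpow_const fun _ => Or.inr (sub_nonneg.2 hq.le)).mul hRc.sqrt).continuousOn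
    (fun x hx => by
      have hY : dualArc q (1 / 2) ≤ dualArc q x := by
        have := hx.1.le
        have := hx.2.le
        unfold dualArc
        gcongr
      have hsq : √(1 - (1 / 2 : ℝ) ^ (2 - q)) * x ^ (q / 2) ≤ √(casimirSq q b x) := by
        rw [show q / 2 = q * (1 / 2) by ring, Real.rpow_mul hx.1.le, ← Real.sqrt_eq_rpow,
          ← Real.sqrt_mul hδ.le]
        exact Real.sqrt_le_sqrt (le_casimirSq hq hq2 hb1 hε1 hx)
      rw [mul_assoc]
      have hY0 := dualArc_nonneg hq (x := 1 / 2) ⟨by norm_num, hε1.le⟩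
      exact mul_le_mul (Real.rpow_le_rpow hY0 hY (by linarith)) hsq
        (mul_nonneg (Real.sqrt_nonneg _) (Real.rpow_nonneg hx.1.le _))
        (Real.rpow_nonneg (hY0.trans hY) _))
  have hpow0 : (0 : ℝ) ^ (q - 1) = 0 := Real.zero_rpow (by linarith)
  refine ⟨T, hT, 0, 1, 0, ?_, x, fun t => dualArc q (x t), fun t => -√(casimirSq q b (x t)),
    fun _ => 0, fun _ => 1, fun _ => 0, _, _,
    vertExtremal_of_hasDerivAt hpq hT hxc (hYc.comp hxc) (hRc.comp hxc).sqrt.neg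
      (fun t ht => (hx t ht).1.1.le)
      (fun t ht => dualArc_nonneg hq (Ioo_subset_Icc_self (hsub _ (hx t ht).1)))
      (fun t ht => rpow_add_dualArc_rpow hq (Ioo_subset_Icc_self (hsub _ (hx t ht).1)))
      (fun t ht => (hx t ht).2.congr_deriv (by ring)) (fun t ht => ?_) (fun t ht => ?_),
    vertExtremal_of_hasDerivAt hpq hT continuous_const continuous_const continuous_const
      (fun _ _ => le_rfl) (fun _ _ => zero_le_one) (fun _ _ => by simp [hq0])
      (fun t _ => (hasDerivAt_const t _).congr_deriv (by simp))
      (fun t _ => (hasDerivAt_const t _).congr_deriv (by simp))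
      (fun t _ => (hasDerivAt_const t _).congr_deriv (by simp [hpow0])),
    hx0, by simp [hx0, dualArc_zero hq], by simp [hx0, casimirSq_zero hq], rfl, rfl, rfl,
    T, right_mem_Icc.2 hT.le, ?_⟩
  · rw [suppFn_lpBall_eq_one hpq le_rfl zero_le_one (by simp [hq0])]
    exact one_pos
  · have hmem := hsub _ (hx t ht).1
    have hu := Real.rpow_pos_of_pos (dualArc_pos hq (Ioo_subset_Ico_self hmem)) (q - 1)
    refine ((hasDerivAt_dualArc hq hmem).comp t (hx t ht).2).congr_deriv ?_
    field_simp
  · have hmem := hsub _ (hx t ht).1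
    have hu := Real.rpow_pos_of_pos (dualArc_pos hq (Ioo_subset_Ico_self hmem)) (q - 1)
    have hS := Real.sqrt_pos.2 (hR _ (hx t ht).1)
    refine (((hasDerivAt_casimirSq hq b hmem).comp t (hx t ht).2).sqrt
      (hR _ (hx t ht).1).ne').neg.congr_deriv ?_
    simp only [Function.comp_apply]
    field_simp
  · simp [hxT]
end
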